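/- Let 0 < T < ∞ and let λ^{(1)}, λ^{(2)} : [0,T] → ℝ be continuous. For j = 1, 2 let h^{(j)}_t(z) solve the backward Loewner equation with driver λ^{(j)}, and let u₁, u₂ ∈ ℍ with Im u₁ = Im u₂ = y, assuming z ↦ h^{(j)}_T(z) is complex-differentiable at u_j. Set ε = sup_{s∈[0,T]} |λ^{(1)}_s − λ^{(2)}_s|, I_{T,y} = √(4T + y²) and A_j = I_{T,y}|(h^{(j)}_T)'(u_j)|/y. Then |h^{(1)}_T(u₁) − h^{(2)}_T(u₂)| ≤ |Re u₁ − Re u₂| · I_{T,y}/y + ε · exp[ (1/2)(log A₁ · log A₂)^{1/2} + log log(I_{T,y}/y) ]. -/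

import Mathlib

open MeasureTheory Filter Set

noncomputable section

/-- The open upper half-plane. -/
def UHP : Set ℂ := {z : ℂ | 0 < z.im}

/-- `h` solves the backward Loewner equation `∂ₜ h(t) = −2/(h(t) − lam(t))`, `h(0) = z`,
on `[0, T]`, staying in the upper half-plane. -/
def IsBwdSolOn (lam : ℝ → ℝ) (z : ℂ) (h : ℝ → ℂ) (T : ℝ) : Prop :=
  h 0 = z ∧ ∀ t ∈ Set.Icc (0:ℝ) T, 0 < (h t).im ∧
    HasDerivAt h (-2 / (h t - (lam t : ℂ))) t


theorem lin_ode {T : ℝ} (hT : 0 ≤ T) {F g k : ℝ → ℂ} (hg : Continuous g) (hk : Continuous k)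
    (hF : ∀ t ∈ Icc (0:ℝ) T, HasDerivAt F (g t * F t + k t) t) :
    F T = Complex.exp (∫ s in (0:ℝ)..T, g s) * F 0 +
      ∫ s in (0:ℝ)..T, k s * Complex.exp (∫ r in s..T, g r) := by
  have hG : ∀ t, HasDerivAt (fun t => ∫ r in t..T, g r) (-g t) t := fun t =>
    intervalIntegral.integral_hasDerivAt_left (hg.intervalIntegrable _ _)
      hg.aestronglyMeasurable.stronglyMeasurableAtFilter hg.continuousAt
  have hGc : Continuous (fun t => ∫ r in t..T, g r) :=
    continuous_iff_continuousAt.2 fun t => (hG t).continuousAt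
  have key := intervalIntegral.integral_eq_sub_of_hasDerivAt
    (f := fun t => F t * Complex.exp (∫ r in t..T, g r))
    (f' := fun s => k s * Complex.exp (∫ r in s..T, g r)) (a := 0) (b := T) (by
      intro t ht
      rw [uIcc_of_le hT] at ht
      have := (hF t ht).mul (hG t).cexp
      refine this.congr_deriv ?_
      ring) (Continuous.intervalIntegrable (hk.mul hGc.cexp) _ _)
  rw [key]
  simp
  ring

theorem re_integral {a b : ℝ} {g : ℝ → ℂ} (hg : Continuous g) :
    (∫ s in a..b, g s).re = ∫ s in a..b, (g s).re :=
  (Complex.reCLM.intervalIntegral_comp_comm (hg.intervalIntegrable a b)).symm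

theorem lin_ode_bound {T : ℝ} (hT : 0 ≤ T) {F g k : ℝ → ℂ} (hg : Continuous g) (hk : Continuous k)
    (hF : ∀ t ∈ Icc (0:ℝ) T, HasDerivAt F (g t * F t + k t) t) {ε B : ℝ}
    (hkb : ∀ t ∈ Icc (0:ℝ) T, ‖k t‖ ≤ ε * ‖g t‖)
    (hB : ∀ s ∈ Icc (0:ℝ) T, ∫ r in s..T, (g r).re ≤ B) :
    ‖F T‖ ≤ Real.exp (∫ s in (0:ℝ)..T, ‖g s‖) * ‖F 0‖ +
      ε * ((∫ s in (0:ℝ)..T, ‖g s‖) * Real.exp B) := by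
  rw [lin_ode hT hg hk hF]
  refine (norm_add_le _ _).trans (add_le_add ?_ ?_)
  · rw [norm_mul, Complex.norm_exp]
    gcongr
    rw [re_integral hg]
    exact intervalIntegral.integral_mono_on hT ((Complex.continuous_re.comp hg).intervalIntegrable _ _)
      (hg.norm.intervalIntegrable _ _) fun s _ => Complex.re_le_norm _
  · have : ε * ((∫ s in (0:ℝ)..T, ‖g s‖) * Real.exp B) =
        ∫ s in (0:ℝ)..T, ε * ‖g s‖ * Real.exp B := by
      simp only [mul_assoc]
      rw [intervalIntegral.integral_const_mul, intervalIntegral.integral_mul_const]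
    rw [this]
    refine intervalIntegral.norm_integral_le_of_norm_le hT ?_
      (Continuous.intervalIntegrable (by fun_prop) _ _)
    refine Eventually.of_forall fun s hs => ?_
    have hs' : s ∈ Icc (0:ℝ) T := Ioc_subset_Icc_self hs
    rw [norm_mul, Complex.norm_exp, re_integral hg]
    have h1 := hkb s hs'
    have h2 := Real.exp_le_exp.2 (hB s hs')
    exact mul_le_mul h1 h2 (Real.exp_pos _).le ((norm_nonneg _).trans h1)

theorem cs_int {T : ℝ} (hT : 0 ≤ T) {p q : ℝ → ℝ} (hp : Continuous p) (hq : Continuous q) :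
    ∫ s in (0:ℝ)..T, p s * q s ≤
      Real.sqrt ((∫ s in (0:ℝ)..T, p s ^ 2) * ∫ s in (0:ℝ)..T, q s ^ 2) := by
  apply Real.le_sqrt_of_sq_le
  have h : ∀ c : ℝ, 0 ≤ (∫ s in (0:ℝ)..T, p s ^ 2) * (c * c) +
      (2 * ∫ s in (0:ℝ)..T, p s * q s) * c + ∫ s in (0:ℝ)..T, q s ^ 2 := by
    intro c
    have h0 : 0 ≤ ∫ s in (0:ℝ)..T, (p s ^ 2 * (c * c) + p s * q s * (2 * c)) + q s ^ 2 :=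
      intervalIntegral.integral_nonneg hT fun s _ => by nlinarith [sq_nonneg (p s * c + q s)]
    rw [intervalIntegral.integral_add (Continuous.intervalIntegrable (by fun_prop) _ _)
      (Continuous.intervalIntegrable (by fun_prop) _ _),
      intervalIntegral.integral_add (Continuous.intervalIntegrable (by fun_prop) _ _)
      (Continuous.intervalIntegrable (by fun_prop) _ _),
      intervalIntegral.integral_mul_const, intervalIntegral.integral_mul_const] at h0
    linarith
  have := discrim_le_zero h
  unfold discrim at this
  linarith

/-- A global continuous version of the centred flow. -/
structure BLFlow (T : ℝ) (lam : ℝ → ℝ) (u : ℂ) (h Z : ℝ → ℂ) : Prop where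
  cont : Continuous Z
  im_pos : ∀ t, 0 < (Z t).im
  start_eq : h 0 = u
  eq : ∀ t ∈ Icc (0:ℝ) T, Z t = h t - lam t
  der : ∀ t ∈ Icc (0:ℝ) T, HasDerivAt h (-2 / Z t) t

theorem exists_flow {T : ℝ} (hT : 0 < T) {lam : ℝ → ℝ} (hl : ContinuousOn lam (Icc 0 T))
    {u : ℂ} {h : ℝ → ℂ} (hs : IsBwdSolOn lam u h T) : ∃ Z, BLFlow T lam u h Z := by
  have hc : ContinuousOn (fun t => h t - (lam t : ℂ)) (Icc 0 T) := by
    refine ContinuousOn.sub (fun t ht => (hs.2 t ht).2.continuousAt.continuousWithinAt) ?_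
    exact Complex.continuous_ofReal.comp_continuousOn hl
  have heq : ∀ t ∈ Icc (0:ℝ) T,
      IccExtend hT.le ((Icc 0 T).domRestrict fun t => h t - (lam t : ℂ)) t = h t - lam t := by
    intro t ht
    rw [IccExtend_of_mem _ _ ht]; rfl
  refine ⟨IccExtend hT.le ((Icc 0 T).domRestrict fun t => h t - (lam t : ℂ)), ?_, ?_, hs.1, heq, ?_⟩
  · exact (continuousOn_iff_continuous_domRestrict.1 hc).Icc_extend'
  · intro t
    simp only [IccExtend, Function.comp, domRestrict_apply]
    have := (hs.2 _ (projIcc 0 T hT.le t).2).1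
    simpa using this
  · intro t ht
    rw [heq t ht]
    exact (hs.2 t ht).2

section
variable {T : ℝ} {lam : ℝ → ℝ} {u : ℂ} {h Z : ℝ → ℂ}

theorem BLFlow.ne (f : BLFlow T lam u h Z) (t : ℝ) : Z t ≠ 0 := by
  intro h0
  have := f.im_pos t
  simp [h0] at this

theorem BLFlow.mono (f : BLFlow T lam u h Z) {t : ℝ} (ht : t ≤ T) : BLFlow t lam u h Z :=
  ⟨f.cont, f.im_pos, f.start_eq, fun s hs => f.eq s ⟨hs.1, hs.2.trans ht⟩,
    fun s hs => f.der s ⟨hs.1, hs.2.trans ht⟩⟩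

theorem BLFlow.im_eq (f : BLFlow T lam u h Z) {t : ℝ} (ht : t ∈ Icc (0:ℝ) T) :
    (h t).im = (Z t).im := by
  rw [f.eq t ht]; simp

theorem BLFlow.normSq_pos (f : BLFlow T lam u h Z) (t : ℝ) : 0 < Complex.normSq (Z t) :=
  Complex.normSq_pos.2 (f.ne t)

theorem BLFlow.cont_normSq (f : BLFlow T lam u h Z) : Continuous fun t => Complex.normSq (Z t) :=
  Complex.continuous_normSq.comp f.cont

theorem BLFlow.hasDerivAt_im (f : BLFlow T lam u h Z) {t : ℝ} (ht : t ∈ Icc (0:ℝ) T) :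
    HasDerivAt (fun t => (h t).im) (2 * (Z t).im / Complex.normSq (Z t)) t := by
  have := Complex.imCLM.hasFDerivAt.comp_hasDerivAt t (f.der t ht)
  refine this.congr_deriv ?_
  simp [Complex.div_im]
  ring

theorem BLFlow.int_log (hT : 0 ≤ T) (f : BLFlow T lam u h Z) :
    ∫ s in (0:ℝ)..T, 2 / Complex.normSq (Z s) = Real.log ((h T).im / u.im) := by
  have hn := fun s => (f.normSq_pos s).ne'
  have key := intervalIntegral.integral_eq_sub_of_hasDerivAt
    (f := fun t => Real.log (h t).im)
    (f' := fun s => 2 / Complex.normSq (Z s)) (a := 0) (b := T) (by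
      intro t ht
      rw [uIcc_of_le hT] at ht
      have hp : (h t).im ≠ 0 := by rw [f.im_eq ht]; exact (f.im_pos t).ne'
      have := (f.hasDerivAt_im ht).log hp
      refine this.congr_deriv ?_
      rw [f.im_eq ht] at *
      have := hn t
      field_simp)
      (Continuous.intervalIntegrable (continuous_const.div f.cont_normSq hn) _ _)
  have h1 : (h T).im ≠ 0 := by
    rw [f.im_eq (right_mem_Icc.2 hT)]; exact (f.im_pos _).ne'
  have h2 : (h 0).im ≠ 0 := by
    rw [f.im_eq (left_mem_Icc.2 hT)]; exact (f.im_pos _).ne'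
  rw [key, ← f.start_eq, Real.log_div h1 h2]

theorem BLFlow.u_im (hT : 0 ≤ T) (f : BLFlow T lam u h Z) : 0 < u.im := by
  rw [← f.start_eq, f.im_eq (left_mem_Icc.2 hT)]; exact f.im_pos _

theorem BLFlow.h_im (hT : 0 ≤ T) (f : BLFlow T lam u h Z) : 0 < (h T).im := by
  rw [f.im_eq (right_mem_Icc.2 hT)]; exact f.im_pos _

theorem BLFlow.im_ge (hT : 0 ≤ T) (f : BLFlow T lam u h Z) : u.im ≤ (h T).im := by
  have h0 : 0 ≤ Real.log ((h T).im / u.im) := by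
    rw [← f.int_log hT]
    exact intervalIntegral.integral_nonneg hT fun s _ =>
      div_nonneg zero_le_two (f.normSq_pos s).le
  have hu := f.u_im hT
  rw [Real.log_nonneg_iff (div_pos (f.h_im hT) hu), one_le_div hu] at h0
  exact h0

theorem BLFlow.norm_ge {t : ℝ} (ht : t ∈ Icc (0:ℝ) T) (f : BLFlow T lam u h Z) : u.im ≤ ‖Z t‖ := by
  have := (f.mono ht.2).im_ge ht.1
  rw [f.im_eq ht] at this
  exact this.trans ((le_abs_self _).trans (Complex.abs_im_le_norm _))

theorem BLFlow.im_le (hT : 0 ≤ T) (f : BLFlow T lam u h Z) :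
    (h T).im ≤ Real.sqrt (4 * T + u.im ^ 2) := by
  have hn := fun s => (f.normSq_pos s).ne'
  have hc : Continuous fun s => 4 * (Z s).im ^ 2 / Complex.normSq (Z s) :=
    Continuous.div (by have := f.cont; fun_prop) f.cont_normSq hn
  have key := intervalIntegral.integral_eq_sub_of_hasDerivAt
    (f := fun t => (h t).im ^ 2)
    (f' := fun s => 4 * (Z s).im ^ 2 / Complex.normSq (Z s)) (a := 0) (b := T) (by
      intro t ht
      rw [uIcc_of_le hT] at ht
      have := (f.hasDerivAt_im ht).pow 2
      refine this.congr_deriv ?_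
      rw [f.im_eq ht]
      norm_num
      ring) (hc.intervalIntegrable _ _)
  have h2 : ∫ s in (0:ℝ)..T, 4 * (Z s).im ^ 2 / Complex.normSq (Z s) ≤ ∫ s in (0:ℝ)..T, (4:ℝ) := by
    refine intervalIntegral.integral_mono_on hT (hc.intervalIntegrable _ _)
      (continuous_const.intervalIntegrable _ _) fun s _ => ?_
    rw [div_le_iff₀ (f.normSq_pos s), Complex.normSq_apply]
    nlinarith [sq_nonneg (Z s).re]
  apply Real.le_sqrt_of_sq_le
  simp [f.start_eq] at key h2
  linarith

end

theorem BLFlow.diff {T : ℝ} {lam : ℝ → ℝ} {u w : ℂ} {h k Z W : ℝ → ℂ}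
    (hT : 0 ≤ T) (f : BLFlow T lam u h Z) (g : BLFlow T lam w k W) :
    k T - h T = Complex.exp (∫ s in (0:ℝ)..T, 2 / (Z s * W s)) * (w - u) := by
  have := lin_ode hT (F := fun t => k t - h t) (g := fun s => 2 / (Z s * W s)) (k := fun _ => 0)
    (continuous_const.div (f.cont.mul g.cont) fun s => mul_ne_zero (f.ne s) (g.ne s))
    continuous_const (by
      intro t ht
      have := (g.der t ht).sub (f.der t ht)
      refine this.congr_deriv ?_
      have e : k t - h t = W t - Z t := by rw [f.eq t ht, g.eq t ht]; ring
      have h1 := f.ne t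
      have h2 := g.ne t
      rw [e]
      field_simp
      ring)
  simpa [f.start_eq, g.start_eq] using this

theorem blflow_deriv_eq {T : ℝ} (hT : 0 < T) {lam : ℝ → ℝ} (hl : ContinuousOn lam (Icc 0 T))
    {h : ℝ → ℂ → ℂ} (hs : ∀ z ∈ UHP, IsBwdSolOn lam z (fun t => h t z) T)
    {u d : ℂ} (hd : HasDerivAt (h T) d u) {Z : ℝ → ℂ} (f : BLFlow T lam u (fun t => h t u) Z) :
    d = Complex.exp (∫ s in (0:ℝ)..T, 2 / (Z s) ^ 2) := by
  have hu := f.u_im hT.le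
  have hex : ∀ w : ℂ, ∃ W, w ∈ UHP → BLFlow T lam w (fun t => h t w) W := by
    intro w
    by_cases hw : w ∈ UHP
    · obtain ⟨W, hW⟩ := exists_flow hT hl (hs w hw)
      exact ⟨W, fun _ => hW⟩
    · exact ⟨0, fun h => absurd h hw⟩
  choose W hW using hex
  have hnear : ∀ᶠ w in nhds u, u.im / 2 < w.im :=
    Complex.continuous_im.continuousAt.eventually (lt_mem_nhds (half_lt_self hu))
  set y := u.im with hy
  have hb : ∀ w : ℂ, y / 2 < w.im → ∀ s ∈ Icc (0:ℝ) T, ‖2 / (Z s * W w s)‖ ≤ 2 / (y * (y / 2)) := by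
    intro w hw s hs
    have g := hW w (show 0 < w.im by linarith)
    rw [norm_div, norm_mul]
    have h1 := f.norm_ge hs
    have h2 := g.norm_ge hs
    simp only [Complex.norm_ofNat]
    have h3 : y / 2 ≤ ‖W w s‖ := by linarith
    gcongr
  set C := Real.exp (2 / (y * (y / 2)) * T) with hC
  have hdiff : ∀ w : ℂ, y / 2 < w.im → ∀ t ∈ Icc (0:ℝ) T, ‖W w t - Z t‖ ≤ C * ‖w - u‖ := by
    intro w hw t ht
    have g := hW w (show 0 < w.im by linarith)
    have e : W w t - Z t = h t w - h t u := by rw [f.eq t ht, g.eq t ht]; ring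
    rw [e, (f.mono ht.2).diff ht.1 (g.mono ht.2), norm_mul]
    gcongr
    rw [Complex.norm_exp, hC, Real.exp_le_exp]
    refine (Complex.re_le_norm _).trans ?_
    refine (intervalIntegral.norm_integral_le_of_norm_le_const (C := 2 / (y * (y / 2))) ?_).trans ?_
    · intro s hs
      rw [uIoc_of_le ht.1] at hs
      exact hb w hw s ⟨hs.1.le, hs.2.trans ht.2⟩
    · rw [sub_zero, abs_of_nonneg ht.1]
      gcongr
      exact ht.2
  have hlim : Tendsto (fun w => ∫ s in (0:ℝ)..T, 2 / (Z s * W w s)) (nhds u)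
      (nhds (∫ s in (0:ℝ)..T, 2 / (Z s) ^ 2)) := by
    rw [tendsto_iff_norm_sub_tendsto_zero]
    have hz : Tendsto (fun w : ℂ => (2 / (y * (y / 2)) * (C * ‖w - u‖) / y) * T) (nhds u) (nhds 0) := by
      have : Continuous (fun w : ℂ => (2 / (y * (y / 2)) * (C * ‖w - u‖) / y) * T) := by fun_prop
      have := this.tendsto u
      simpa using this
    refine squeeze_zero' (Eventually.of_forall fun _ => norm_nonneg _) ?_ hz
    filter_upwards [hnear] with w hw
    have g := hW w (show 0 < w.im by linarith)
    rw [← intervalIntegral.integral_sub]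
    rotate_left
    · exact Continuous.intervalIntegrable (continuous_const.div (f.cont.mul g.cont)
        fun s => mul_ne_zero (f.ne s) (g.ne s)) _ _
    · exact Continuous.intervalIntegrable (continuous_const.div (f.cont.pow 2)
        fun s => pow_ne_zero _ (f.ne s)) _ _
    refine (intervalIntegral.norm_integral_le_of_norm_le_const
      (C := 2 / (y * (y / 2)) * (C * ‖w - u‖) / y) ?_).trans ?_
    · intro s hs
      rw [uIoc_of_le hT.le] at hs
      have hs' : s ∈ Icc (0:ℝ) T := ⟨hs.1.le, hs.2⟩
      have h1 := f.ne s
      have h2 := g.ne s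
      have e : 2 / (Z s * W w s) - 2 / (Z s) ^ 2 = - (2 / (Z s * W w s) * (W w s - Z s) / Z s) := by
        field_simp
        ring
      rw [e, norm_neg, norm_div, norm_mul]
      have := hb w hw s hs'
      have := hdiff w hw s hs'
      have := f.norm_ge hs'
      gcongr
    · rw [sub_zero, abs_of_pos hT]
  have hE := (Complex.continuous_exp.tendsto _).comp hlim
  have hS := hasDerivAt_iff_tendsto_slope.1 hd
  refine tendsto_nhds_unique hS ((hE.mono_left nhdsWithin_le_nhds).congr' ?_)
  filter_upwards [self_mem_nhdsWithin, nhdsWithin_le_nhds hnear] with w hne hw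
  have g := hW w (show 0 < w.im by linarith)
  have hne' : w - u ≠ 0 := sub_ne_zero.2 hne
  have := f.diff hT.le g
  simp only [Function.comp, slope_def_field]
  rw [this]
  field_simp

theorem log_deriv {T : ℝ} (hT : 0 < T) {lam : ℝ → ℝ} (hl : ContinuousOn lam (Icc 0 T))
    {h : ℝ → ℂ → ℂ} (hs : ∀ z ∈ UHP, IsBwdSolOn lam z (fun t => h t z) T)
    {u d : ℂ} (hd : HasDerivAt (h T) d u) {Z : ℝ → ℂ} (f : BLFlow T lam u (fun t => h t u) Z) :
    ∫ s in (0:ℝ)..T, (2 * |(Z s).re| / Complex.normSq (Z s)) ^ 2 ≤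
      Real.log (Real.sqrt (4 * T + u.im ^ 2) * ‖d‖ / u.im) := by
  have hn := fun s => (f.normSq_pos s).ne'
  have hu := f.u_im hT.le
  have c1 : Continuous fun s => 2 / (Z s) ^ 2 :=
    continuous_const.div (f.cont.pow 2) fun s => pow_ne_zero _ (f.ne s)
  have c2 : Continuous fun s => 2 / Complex.normSq (Z s) := continuous_const.div f.cont_normSq hn
  have hdn : Real.log ‖d‖ = ∫ s in (0:ℝ)..T, (2 / (Z s) ^ 2).re := by
    rw [blflow_deriv_eq hT hl hs hd f, Complex.norm_exp, Real.log_exp, re_integral c1]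
  have hd0 : 0 < ‖d‖ := by
    rw [blflow_deriv_eq hT hl hs hd f, Complex.norm_exp]; exact Real.exp_pos _
  have e : ∫ s in (0:ℝ)..T, (2 * |(Z s).re| / Complex.normSq (Z s)) ^ 2 =
      Real.log ‖d‖ + Real.log ((h T u).im / u.im) := by
    have c1' : Continuous fun s => (2 / (Z s) ^ 2).re := Complex.continuous_re.comp c1
    rw [hdn, ← f.int_log hT.le, ← intervalIntegral.integral_add
      (c1'.intervalIntegrable _ _) (c2.intervalIntegrable _ _)]
    refine intervalIntegral.integral_congr fun s _ => ?_
    have h1 := hn s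
    simp only [div_pow, mul_pow, sq_abs, Complex.div_re, map_pow]
    field_simp
    simp [pow_two, Complex.normSq_apply]
    ring
  have hT' := f.h_im hT.le
  rw [e, ← Real.log_mul hd0.ne' (div_pos hT' hu).ne']
  refine Real.log_le_log (by positivity) ?_
  have := f.im_le hT.le
  calc ‖d‖ * ((h T u).im / u.im) = (h T u).im * ‖d‖ / u.im := by ring
    _ ≤ _ := by gcongr

/-- **Backward Loewner maps with close drivers and close starting points are close**
(inequality (8), the modification of Lemma 2.3 of Johansson Viklund–Rohde–Wong).
Let `0 < T < ∞`, let `λ⁽¹⁾, λ⁽²⁾ : [0,T] → ℝ` be continuous, let `h⁽ʲ⁾` solve the backward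
Loewner equation with driver `λ⁽ʲ⁾`, and let `u₁, u₂ ∈ ℍ` with `Im u₁ = Im u₂ = y`, with
`z ↦ h⁽ʲ⁾_T(z)` complex-differentiable at `u_j`. With `ε = sup_{s∈[0,T]} |λ⁽¹⁾_s − λ⁽²⁾_s|`,
`I_{T,y} = √(4T + y²)` and `A_j = I_{T,y}|(h⁽ʲ⁾_T)'(u_j)|/y`,
`|h⁽¹⁾_T(u₁) − h⁽²⁾_T(u₂)| ≤ |Re u₁ − Re u₂|·I_{T,y}/y
  + ε·exp[ ½(log A₁ · log A₂)^{1/2} + log log(I_{T,y}/y) ]`. -/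
theorem backward_loewner_uniform_close_two_points
    (T : ℝ) (hT : 0 < T)
    (lam1 lam2 : ℝ → ℝ)
    (hl1 : ContinuousOn lam1 (Set.Icc 0 T)) (hl2 : ContinuousOn lam2 (Set.Icc 0 T))
    (h1 h2 : ℝ → ℂ → ℂ)
    (hsol1 : ∀ z ∈ UHP, IsBwdSolOn lam1 z (fun t => h1 t z) T)
    (hsol2 : ∀ z ∈ UHP, IsBwdSolOn lam2 z (fun t => h2 t z) T)
    (u₁ u₂ : ℂ) (hy : 0 < u₁.im) (him : u₁.im = u₂.im)
    (d1 d2 : ℂ) (hd1 : HasDerivAt (h1 T) d1 u₁) (hd2 : HasDerivAt (h2 T) d2 u₂) :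
    ‖h1 T u₁ - h2 T u₂‖ ≤
      |u₁.re - u₂.re| * (Real.sqrt (4 * T + u₁.im ^ 2) / u₁.im) +
      sSup ((fun s => |lam1 s - lam2 s|) '' Set.Icc (0:ℝ) T) *
        Real.exp ((1/2) *
            Real.sqrt (Real.log (Real.sqrt (4 * T + u₁.im ^ 2) * ‖d1‖ / u₁.im) *
              Real.log (Real.sqrt (4 * T + u₁.im ^ 2) * ‖d2‖ / u₁.im))
          + Real.log (Real.log (Real.sqrt (4 * T + u₁.im ^ 2) / u₁.im))) := by
  obtain ⟨Z, f⟩ := exists_flow hT hl1 (hsol1 u₁ hy)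
  obtain ⟨W, g⟩ := exists_flow hT hl2 (hsol2 u₂ (show 0 < u₂.im from him ▸ hy))
  have L1 := log_deriv hT hl1 hsol1 hd1 f
  have L2 := log_deriv hT hl2 hsol2 hd2 g
  have N1 := f.int_log hT.le
  have N2 := g.int_log hT.le
  have M1 := f.im_le hT.le
  have M2 := g.im_le hT.le
  have P1 := f.h_im hT.le
  have P2 := g.h_im hT.le
  rw [← him] at L2 N2 M2
  set y := u₁.im with hydef
  set I := Real.sqrt (4 * T + y ^ 2) with hI
  set a1 := Real.log (I * ‖d1‖ / y)
  set a2 := Real.log (I * ‖d2‖ / y)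
  set ε := sSup ((fun s => |lam1 s - lam2 s|) '' Set.Icc (0:ℝ) T) with hε
  have hyI : y < I := by
    rw [hI]; apply Real.lt_sqrt_of_sq_lt; linarith
  have hlogpos : 0 < Real.log (I / y) := Real.log_pos ((one_lt_div hy).2 hyI)
  have hεle : ∀ s ∈ Icc (0:ℝ) T, |lam1 s - lam2 s| ≤ ε := fun s hs =>
    le_csSup (isCompact_Icc.image_of_continuousOn (hl1.sub hl2).abs).bddAbove ⟨s, hs, rfl⟩
  have hε0 : 0 ≤ ε := (abs_nonneg _).trans (hεle 0 (left_mem_Icc.2 hT.le))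
  have hψc : Continuous fun s => 2 / (Z s * W s) :=
    continuous_const.div (f.cont.mul g.cont) fun s => mul_ne_zero (f.ne s) (g.ne s)
  have hn1 := fun s => (f.normSq_pos s).ne'
  have hn2 := fun s => (g.normSq_pos s).ne'
  have cA : ContinuousOn (fun s => lam1 s - lam2 s) (Icc 0 T) := hl1.sub hl2
  set L : ℝ → ℝ := IccExtend hT.le ((Icc 0 T).domRestrict fun s => lam1 s - lam2 s) with hL
  have hLc : Continuous L := (continuousOn_iff_continuous_domRestrict.1 cA).Icc_extend'
  have hLe : ∀ s ∈ Icc (0:ℝ) T, L s = lam1 s - lam2 s := fun s hs => by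
    rw [hL, IccExtend_of_mem _ _ hs]; rfl
  have hintg : ∫ s in (0:ℝ)..T, ‖2 / (Z s * W s)‖ ≤ Real.log (I / y) := by
    have c1 : Continuous fun s => Real.sqrt 2 / ‖Z s‖ :=
      continuous_const.div f.cont.norm fun s => norm_ne_zero_iff.2 (f.ne s)
    have c2 : Continuous fun s => Real.sqrt 2 / ‖W s‖ :=
      continuous_const.div g.cont.norm fun s => norm_ne_zero_iff.2 (g.ne s)
    have := cs_int hT.le c1 c2
    simp only [div_pow, Real.sq_sqrt (zero_le_two : (0:ℝ) ≤ 2), ← Complex.normSq_eq_norm_sq] at this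
    rw [N1, N2] at this
    have e : ∀ s, Real.sqrt 2 / ‖Z s‖ * (Real.sqrt 2 / ‖W s‖) = ‖2 / (Z s * W s)‖ := by
      intro s
      rw [div_mul_div_comm, Real.mul_self_sqrt zero_le_two]
      simp
    simp only [e] at this
    refine this.trans ?_
    apply Real.sqrt_le_iff.2 ⟨hlogpos.le, ?_⟩
    have b1 : Real.log ((h1 T u₁).im / y) ≤ Real.log (I / y) :=
      Real.log_le_log (by positivity) (by gcongr)
    have b2 : Real.log ((h2 T u₂).im / y) ≤ Real.log (I / y) :=
      Real.log_le_log (by positivity) (by gcongr)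
    have b3 : 0 ≤ Real.log ((h2 T u₂).im / y) := by
      rw [← N2]
      exact intervalIntegral.integral_nonneg hT.le fun s _ =>
        div_nonneg zero_le_two (g.normSq_pos s).le
    rw [sq]
    exact mul_le_mul b1 b2 b3 hlogpos.le
  have hre : ∀ s ∈ Icc (0:ℝ) T, ∫ r in s..T, (2 / (Z r * W r)).re ≤ (1/2) * Real.sqrt (a1 * a2) := by
    intro s hs
    have c1 : Continuous fun s => 2 * |(Z s).re| / Complex.normSq (Z s) :=
      Continuous.div (by have := f.cont; fun_prop) f.cont_normSq hn1
    have c2 : Continuous fun s => 2 * |(W s).re| / Complex.normSq (W s) :=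
      Continuous.div (by have := g.cont; fun_prop) g.cont_normSq hn2
    have c3 : Continuous fun r => (1/2) * (2 * |(Z r).re| / Complex.normSq (Z r) *
        (2 * |(W r).re| / Complex.normSq (W r))) := continuous_const.mul (c1.mul c2)
    have nn1 : ∀ s, 0 ≤ 2 * |(Z s).re| / Complex.normSq (Z s) := fun s =>
      div_nonneg (by positivity) (f.normSq_pos s).le
    have nn2 : ∀ s, 0 ≤ 2 * |(W s).re| / Complex.normSq (W s) := fun s =>
      div_nonneg (by positivity) (g.normSq_pos s).le
    calc ∫ r in s..T, (2 / (Z r * W r)).re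
        ≤ ∫ r in s..T, (1/2) * (2 * |(Z r).re| / Complex.normSq (Z r) *
          (2 * |(W r).re| / Complex.normSq (W r))) := by
          refine intervalIntegral.integral_mono_on hs.2
            ((Complex.continuous_re.comp hψc).intervalIntegrable _ _)
            (c3.intervalIntegrable _ _) fun r _ => ?_
          have p1 := f.normSq_pos r
          have p2 := g.normSq_pos r
          have q1 := f.im_pos r
          have q2 := g.im_pos r
          have e1 : (2 / (Z r * W r)).re = 2 * ((Z r).re * (W r).re - (Z r).im * (W r).im) /
              (Complex.normSq (Z r) * Complex.normSq (W r)) := by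
            simp [Complex.div_re]
          have e2 : (1/2) * (2 * |(Z r).re| / Complex.normSq (Z r) *
              (2 * |(W r).re| / Complex.normSq (W r))) = 2 * |(Z r).re * (W r).re| /
              (Complex.normSq (Z r) * Complex.normSq (W r)) := by
            rw [abs_mul]; field_simp
          rw [e1, e2]
          gcongr
          have := le_abs_self ((Z r).re * (W r).re)
          have := mul_pos q1 q2
          linarith
      _ ≤ ∫ r in (0:ℝ)..T, (1/2) * (2 * |(Z r).re| / Complex.normSq (Z r) *
          (2 * |(W r).re| / Complex.normSq (W r))) := by
          rw [← intervalIntegral.integral_add_adjacent_intervals (c3.intervalIntegrable 0 s)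
            (c3.intervalIntegrable s T)]
          have := intervalIntegral.integral_nonneg (μ := volume) hs.1 (f := fun r =>
            (1/2) * (2 * |(Z r).re| / Complex.normSq (Z r) *
              (2 * |(W r).re| / Complex.normSq (W r)))) fun r _ =>
            mul_nonneg (by norm_num) (mul_nonneg (nn1 r) (nn2 r))
          linarith
      _ ≤ _ := by
          rw [intervalIntegral.integral_const_mul]
          refine mul_le_mul_of_nonneg_left ((cs_int hT.le c1 c2).trans ?_) (by norm_num)
          apply Real.sqrt_le_sqrt
          have i1 : 0 ≤ ∫ s in (0:ℝ)..T, (2 * |(Z s).re| / Complex.normSq (Z s)) ^ 2 :=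
            intervalIntegral.integral_nonneg hT.le fun s _ => sq_nonneg _
          have i2 : 0 ≤ ∫ s in (0:ℝ)..T, (2 * |(W s).re| / Complex.normSq (W s)) ^ 2 :=
            intervalIntegral.integral_nonneg hT.le fun s _ => sq_nonneg _
          exact mul_le_mul L1 L2 i2 (i1.trans L1)
  have main := lin_ode_bound hT.le (F := fun t => h1 t u₁ - h2 t u₂)
    (g := fun s => 2 / (Z s * W s)) (k := fun s => -(2 / (Z s * W s) * (L s : ℂ)))
    (ε := ε) (B := (1/2) * Real.sqrt (a1 * a2)) hψc
    (hψc.mul (Complex.continuous_ofReal.comp hLc)).neg (by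
      intro t ht
      have := (f.der t ht).sub (g.der t ht)
      refine this.congr_deriv ?_
      have e : h1 t u₁ - h2 t u₂ = Z t - W t + (L t : ℂ) := by
        rw [f.eq t ht, g.eq t ht, hLe t ht]; push_cast; ring
      have n1 := f.ne t
      have n2 := g.ne t
      rw [e]
      field_simp
      ring) (by
      intro t ht
      rw [norm_neg, norm_mul, Complex.norm_real, Real.norm_eq_abs, hLe t ht, mul_comm]
      exact mul_le_mul_of_nonneg_right (hεle t ht) (norm_nonneg _)) hre
  have hF0 : ‖h1 0 u₁ - h2 0 u₂‖ = |u₁.re - u₂.re| := by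
    have e1 : h1 0 u₁ = u₁ := f.start_eq
    have e2 : h2 0 u₂ = u₂ := g.start_eq
    have e3 : u₁ - u₂ = ((u₁.re - u₂.re : ℝ) : ℂ) := by
      apply Complex.ext
      · simp
      · simp only [Complex.sub_im, Complex.ofReal_im]
        linarith
    rw [e1, e2, e3, Complex.norm_real, Real.norm_eq_abs]
  refine main.trans (add_le_add ?_ ?_)
  · simp only [hF0]
    rw [mul_comm]
    refine mul_le_mul_of_nonneg_left ?_ (abs_nonneg _)
    refine (Real.exp_le_exp.2 hintg).trans ?_
    rw [Real.exp_log (div_pos (hy.trans hyI) hy)]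
  · rw [Real.exp_add, Real.exp_log hlogpos, mul_comm (Real.exp _)]
    refine mul_le_mul_of_nonneg_left ?_ hε0
    exact mul_le_mul_of_nonneg_right hintg (Real.exp_pos _).le


end
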